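/- Let K ≥ 2, let α ∈ ℝ^K with α_k > 0 for all k, and let i ≠ j be indices in {1,…,K}. Then ∫_Δ 1_{{θ_i > θ_j}} D_α(θ) dθ = I_{1/2}(α_j, α_i) · ∫_Δ D_α(θ) dθ. -/

import Mathlib

open MeasureTheory Finset

/-- The Beta function `B(a,b) = ∫_0^1 t^(a-1) (1-t)^(b-1) dt`. -/
noncomputable def betaFun (a b : ℝ) : ℝ :=
  ∫ t in Set.Ioo (0:ℝ) 1, t ^ (a - 1) * (1 - t) ^ (b - 1)

/-- The regularized incomplete beta function evaluated at `1/2`. -/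
noncomputable def Ihalf (a b : ℝ) : ℝ :=
  (∫ t in Set.Ioo (0:ℝ) (1/2), t ^ (a - 1) * (1 - t) ^ (b - 1)) / betaFun a b

/-- The parametrizing domain `{y ∈ ℝ^{K-1} : y_k > 0, Σ y_k < 1}` of the open
probability simplex on `K` coordinates. -/
def simplexDomain (K : ℕ) : Set (Fin (K - 1) → ℝ) :=
  {y | (∀ k, 0 < y k) ∧ ∑ k, y k < 1}

/-- The point of the simplex with coordinates `θ_k = y_k` for `k < K-1` and
`θ_K = 1 - Σ y_k`. -/
noncomputable def coordsOf {K : ℕ} (y : Fin (K - 1) → ℝ) : Fin K → ℝ :=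
  fun i => if h : (i : ℕ) < K - 1 then y ⟨(i : ℕ), h⟩ else 1 - ∑ k, y k

/-- `∫_Δ f(θ) dθ`, the integral of `f` over the open probability simplex via the
standard parametrization. -/
noncomputable def simplexIntegral (K : ℕ) (f : (Fin K → ℝ) → ℝ) : ℝ :=
  ∫ y in simplexDomain K, f (coordsOf y)

/-- The unnormalized Dirichlet density `D_α(θ) = ∏ θ_k^(α_k - 1)`. -/
noncomputable def dirDensity {K : ℕ} (α : Fin K → ℝ) (θ : Fin K → ℝ) : ℝ :=
  ∏ k, θ k ^ (α k - 1)

open scoped ENNReal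

/-- `D_α` on the positive orthant, extended by zero. -/
noncomputable def posDensity {K : ℕ} (α θ : Fin K → ℝ) : ℝ≥0∞ :=
  if ∀ k, 0 < θ k then ENNReal.ofReal (dirDensity α θ) else 0

/-- `D_α` on the part of the positive orthant where `θ j < θ i`, extended by zero. -/
noncomputable def posDensityGt {K : ℕ} (α : Fin K → ℝ) (i j : Fin K) (θ : Fin K → ℝ) : ℝ≥0∞ :=
  if (∀ k, 0 < θ k) ∧ θ j < θ i then ENNReal.ofReal (dirDensity α θ) else 0

lemma integrableOn_beta {a b : ℝ} (ha : 0 < a) (hb : 0 < b) :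
    IntegrableOn (fun t : ℝ => t ^ (a - 1) * (1 - t) ^ (b - 1)) (Set.Ioo 0 1) := by
  have h := Complex.betaIntegral_convergent (u := a) (v := b) (by simpa) (by simpa)
  rw [intervalIntegrable_iff_integrableOn_Ioo_of_le zero_le_one] at h
  refine IntegrableOn.congr_fun h.norm (fun t ht => ?_) measurableSet_Ioo
  have h0 : 0 < t := ht.1
  have h1 : 0 < 1 - t := sub_pos.2 ht.2
  have e1 : (t : ℂ) ^ ((a : ℂ) - 1) = ((t ^ (a - 1) : ℝ) : ℂ) := by
    rw [Complex.ofReal_cpow h0.le]; simp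
  have e2 : (1 - (t : ℂ)) ^ ((b : ℂ) - 1) = (((1 - t) ^ (b - 1) : ℝ) : ℂ) := by
    rw [Complex.ofReal_cpow h1.le]; simp
  simp only [e1, e2, norm_mul, Complex.norm_real, Real.norm_eq_abs]
  rw [abs_of_pos (Real.rpow_pos_of_pos h0 _), abs_of_pos (Real.rpow_pos_of_pos h1 _)]

lemma beta_integrand_pos {a b t : ℝ} (ht : t ∈ Set.Ioo (0 : ℝ) 1) :
    0 < t ^ (a - 1) * (1 - t) ^ (b - 1) :=
  mul_pos (Real.rpow_pos_of_pos ht.1 _) (Real.rpow_pos_of_pos (sub_pos.2 ht.2) _)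

lemma Ioo_half_subset : Set.Ioo (0 : ℝ) (1 / 2) ⊆ Set.Ioo 0 1 :=
  Set.Ioo_subset_Ioo_right (by norm_num)

lemma betaFun_pos {a b : ℝ} (ha : 0 < a) (hb : 0 < b) : 0 < betaFun a b := by
  refine (setIntegral_pos_iff_support_of_nonneg_ae ?_ (integrableOn_beta ha hb)).2 ?_
  · filter_upwards [ae_restrict_mem measurableSet_Ioo] with t ht using (beta_integrand_pos ht).le
  · rw [Set.inter_eq_right.2 fun t ht => Function.mem_support.2 (beta_integrand_pos ht).ne']
    simp

lemma Ihalf_nonneg {a b : ℝ} (ha : 0 < a) (hb : 0 < b) : 0 ≤ Ihalf a b :=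
  div_nonneg (setIntegral_nonneg measurableSet_Ioo fun _ ht =>
    (beta_integrand_pos (Ioo_half_subset ht)).le) (betaFun_pos ha hb).le

lemma lintegral_half_beta {a b : ℝ} (ha : 0 < a) (hb : 0 < b) :
    ∫⁻ t in Set.Ioo (0 : ℝ) (1 / 2), ENNReal.ofReal (t ^ (a - 1) * (1 - t) ^ (b - 1)) =
      ENNReal.ofReal (Ihalf a b) *
        ∫⁻ t in Set.Ioo (0 : ℝ) 1, ENNReal.ofReal (t ^ (a - 1) * (1 - t) ^ (b - 1)) := by
  have hint := integrableOn_beta ha hb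
  rw [← ofReal_integral_eq_lintegral_ofReal hint,
    ← ofReal_integral_eq_lintegral_ofReal (hint.mono_set Ioo_half_subset),
    ← ENNReal.ofReal_mul (Ihalf_nonneg ha hb)]
  · congr 1
    exact (div_mul_cancel₀ _ (betaFun_pos ha hb).ne').symm
  · filter_upwards [ae_restrict_mem measurableSet_Ioo] with t ht using
      (beta_integrand_pos (Ioo_half_subset ht)).le
  · filter_upwards [ae_restrict_mem measurableSet_Ioo] with t ht using (beta_integrand_pos ht).le

lemma lintegral_comp_const_mul_one_sub {s : ℝ} (hs : 0 < s) {h : ℝ → ℝ≥0∞} (hh : Measurable h) :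
    ∫⁻ t, h t = ENNReal.ofReal s * ∫⁻ v, h (s * (1 - v)) := by
  rw [lintegral_sub_left_eq_self (fun v => h (s * v)) 1]
  conv_lhs => rw [← Real.smul_map_volume_mul_left hs.ne']
  rw [lintegral_smul_measure, lintegral_map hh (measurable_const_mul s), abs_of_pos hs, smul_eq_mul]

lemma lintegral_segment_gt {a b : ℝ} (ha : 0 < a) (hb : 0 < b) {C : ℝ} (hC : 0 ≤ C) (s : ℝ) :
    ∫⁻ t, (if (0 < t ∧ 0 < s - t) ∧ s - t < t then
        ENNReal.ofReal (C * (t ^ (a - 1) * (s - t) ^ (b - 1))) else 0) =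
      ENNReal.ofReal (Ihalf b a) * ∫⁻ t, (if 0 < t ∧ 0 < s - t then
        ENNReal.ofReal (C * (t ^ (a - 1) * (s - t) ^ (b - 1))) else 0) := by
  rcases le_or_gt s 0 with hs | hs
  · have h (t : ℝ) : ¬ (0 < t ∧ 0 < s - t) := fun h => by linarith [h.1, h.2]
    simp only [h, false_and, if_false, lintegral_zero, mul_zero]
  have hset : MeasurableSet {t : ℝ | 0 < t ∧ 0 < s - t} :=
    (measurableSet_lt measurable_const measurable_id).inter
      (measurableSet_lt measurable_const (measurable_const.sub measurable_id))
  have hset' : MeasurableSet {t : ℝ | (0 < t ∧ 0 < s - t) ∧ s - t < t} :=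
    hset.inter (measurableSet_lt (measurable_const.sub measurable_id) measurable_id)
  have hmeas : Measurable fun t : ℝ =>
      ENNReal.ofReal (C * (t ^ (a - 1) * (s - t) ^ (b - 1))) := by fun_prop
  rw [lintegral_comp_const_mul_one_sub hs (Measurable.ite hset' hmeas measurable_const),
    lintegral_comp_const_mul_one_sub hs (Measurable.ite hset hmeas measurable_const)]
  set c : ℝ := C * (s ^ (a - 1) * s ^ (b - 1)) with hc
  have hc0 : 0 ≤ c := by positivity
  have key {v : ℝ} (hv : v ∈ Set.Ioo (0 : ℝ) 1) :
      ENNReal.ofReal (C * ((s * (1 - v)) ^ (a - 1) * (s - s * (1 - v)) ^ (b - 1))) =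
        ENNReal.ofReal c * ENNReal.ofReal (v ^ (b - 1) * (1 - v) ^ (a - 1)) := by
    rw [← ENNReal.ofReal_mul hc0, show s - s * (1 - v) = s * v by ring,
      Real.mul_rpow hs.le (sub_pos.2 hv.2).le, Real.mul_rpow hs.le hv.1.le, hc]
    congr 1
    ring
  have cond (v : ℝ) : (0 < s * (1 - v) ∧ 0 < s - s * (1 - v)) ↔ v ∈ Set.Ioo (0 : ℝ) 1 := by
    rw [show s - s * (1 - v) = s * v by ring, mul_pos_iff_of_pos_left hs,
      mul_pos_iff_of_pos_left hs, sub_pos, Set.mem_Ioo, and_comm]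
  have cond' (v : ℝ) : ((0 < s * (1 - v) ∧ 0 < s - s * (1 - v)) ∧ s - s * (1 - v) < s * (1 - v)) ↔
      v ∈ Set.Ioo (0 : ℝ) (1 / 2) := by
    rw [cond, show s - s * (1 - v) = s * v by ring, mul_lt_mul_iff_right₀ hs]
    constructor
    · rintro ⟨h1, h2⟩
      exact ⟨h1.1, by linarith⟩
    · rintro ⟨h1, h2⟩
      exact ⟨⟨h1, by linarith⟩, by linarith⟩
  have e1 : ∫⁻ v, (if 0 < s * (1 - v) ∧ 0 < s - s * (1 - v) then
        ENNReal.ofReal (C * ((s * (1 - v)) ^ (a - 1) * (s - s * (1 - v)) ^ (b - 1))) else 0) =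
      ENNReal.ofReal c *
        ∫⁻ v in Set.Ioo (0 : ℝ) 1, ENNReal.ofReal (v ^ (b - 1) * (1 - v) ^ (a - 1)) := by
    rw [← lintegral_const_mul _ (by fun_prop), ← lintegral_indicator measurableSet_Ioo]
    refine lintegral_congr fun v => ?_
    by_cases hv : v ∈ Set.Ioo (0 : ℝ) 1
    · rw [if_pos ((cond v).2 hv), Set.indicator_of_mem hv, key hv]
    · rw [if_neg (mt (cond v).1 hv), Set.indicator_of_notMem hv]
  have e2 : ∫⁻ v, (if (0 < s * (1 - v) ∧ 0 < s - s * (1 - v)) ∧ s - s * (1 - v) < s * (1 - v) then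
        ENNReal.ofReal (C * ((s * (1 - v)) ^ (a - 1) * (s - s * (1 - v)) ^ (b - 1))) else 0) =
      ENNReal.ofReal c *
        ∫⁻ v in Set.Ioo (0 : ℝ) (1 / 2), ENNReal.ofReal (v ^ (b - 1) * (1 - v) ^ (a - 1)) := by
    rw [← lintegral_const_mul _ (by fun_prop), ← lintegral_indicator measurableSet_Ioo]
    refine lintegral_congr fun v => ?_
    by_cases hv : v ∈ Set.Ioo (0 : ℝ) (1 / 2)
    · rw [if_pos ((cond' v).2 hv), Set.indicator_of_mem hv, key (Ioo_half_subset hv)]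
    · rw [if_neg (mt (cond' v).1 hv), Set.indicator_of_notMem hv]
  rw [e1, e2, lintegral_half_beta hb ha]
  ring

section Coordinates

variable {K : ℕ}

lemma measurable_coordsOf : Measurable (coordsOf (K := K)) := by
  refine measurable_pi_lambda _ fun i => ?_
  unfold coordsOf
  split_ifs <;> fun_prop

lemma coordsOf_update {i l : Fin K} {p : Fin (K - 1)} (hi : (i : ℕ) = p) (hl : (l : ℕ) = K - 1)
    (x : Fin (K - 1) → ℝ) (t : ℝ) :
    coordsOf (Function.update x p t) =
      Function.update (Function.update (coordsOf x) i t) l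
        (1 - ∑ k ∈ univ.erase p, x k - t) := by
  funext k
  by_cases hk : k = l
  · subst hk
    rw [Function.update_self, coordsOf, dif_neg (by omega), ← add_sum_erase _ _ (mem_univ p),
      Function.update_self]
    rw [sum_congr rfl fun m hm => Function.update_of_ne (ne_of_mem_erase hm) t x]
    ring
  · have hkl : (k : ℕ) < K - 1 := by
      have := k.2
      have : (k : ℕ) ≠ l := fun h => hk (Fin.ext h)
      omega
    rw [Function.update_of_ne hk]
    by_cases hki : k = i
    · subst hki
      have : (⟨k, hkl⟩ : Fin (K - 1)) = p := Fin.ext hi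
      rw [Function.update_self, coordsOf, dif_pos hkl, this, Function.update_self]
    · have : (⟨k, hkl⟩ : Fin (K - 1)) ≠ p := fun h => hki (Fin.ext (by rw [hi, ← h]))
      rw [Function.update_of_ne hki, coordsOf, dif_pos hkl, Function.update_of_ne this, coordsOf,
        dif_pos hkl]

lemma mem_simplexDomain_iff (hK : 0 < K) (y : Fin (K - 1) → ℝ) :
    y ∈ simplexDomain K ↔ ∀ k, 0 < coordsOf y k := by
  constructor
  · rintro ⟨h1, h2⟩ k
    unfold coordsOf
    split_ifs
    · exact h1 _
    · linarith
  · refine fun h => ⟨fun k => ?_, ?_⟩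
    · have := h ⟨k, by omega⟩
      rwa [coordsOf, dif_pos k.2] at this
    · have := h ⟨K - 1, by omega⟩
      rw [coordsOf, dif_neg (lt_irrefl _)] at this
      linarith

lemma measurableSet_forall_pos : MeasurableSet {θ : Fin K → ℝ | ∀ k, 0 < θ k} := by
  simp only [Set.ofPred_forall]
  exact MeasurableSet.iInter fun k => measurableSet_lt measurable_const (measurable_pi_apply k)

lemma measurableSet_simplexDomain (hK : 0 < K) : MeasurableSet (simplexDomain K) := by
  rw [show simplexDomain K = coordsOf ⁻¹' {θ : Fin K → ℝ | ∀ k, 0 < θ k} from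
    Set.ext (mem_simplexDomain_iff hK)]
  exact measurable_coordsOf measurableSet_forall_pos

lemma measurable_dirDensity (α : Fin K → ℝ) : Measurable (dirDensity α) := by
  unfold dirDensity
  fun_prop

lemma measurable_posDensity (α : Fin K → ℝ) : Measurable (posDensity α) :=
  Measurable.ite measurableSet_forall_pos (measurable_dirDensity α).ennreal_ofReal measurable_const

lemma measurable_posDensityGt (α : Fin K → ℝ) (i j : Fin K) : Measurable (posDensityGt α i j) :=
  Measurable.ite (measurableSet_forall_pos.inter
    (measurableSet_lt (measurable_pi_apply j) (measurable_pi_apply i)))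
    (measurable_dirDensity α).ennreal_ofReal measurable_const

lemma lintegral_eq_of_forall_update {p : Fin (K - 1)} {f g : (Fin (K - 1) → ℝ) → ℝ≥0∞}
    (hf : Measurable f) (hg : Measurable g)
    (h : ∀ x, ∫⁻ t, f (Function.update x p t) = ∫⁻ t, g (Function.update x p t)) :
    ∫⁻ y, f y = ∫⁻ y, g y := by
  refine lintegral_eq_of_lmarginal_eq (μ := fun _ => volume) {p} hf hg ?_
  rw [lmarginal_singleton, lmarginal_singleton]
  exact funext h

lemma lintegral_coordsOf_comp_swap {i l : Fin K} (hil : i ≠ l) (hl : (l : ℕ) = K - 1)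
    {f : (Fin K → ℝ) → ℝ≥0∞} (hf : Measurable f) :
    ∫⁻ y, f (coordsOf y ∘ Equiv.swap i l) = ∫⁻ y, f (coordsOf y) := by
  have hi : (i : ℕ) < K - 1 := by
    have := i.2
    have : (i : ℕ) ≠ l := fun h => hil (Fin.ext h)
    omega
  have hswap : Measurable fun θ : Fin K → ℝ => θ ∘ Equiv.swap i l :=
    measurable_pi_lambda _ fun k => measurable_pi_apply _
  refine lintegral_eq_of_forall_update (p := ⟨i, hi⟩)
    (hf.comp (hswap.comp measurable_coordsOf)) (hf.comp measurable_coordsOf) fun x => ?_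
  simp only [coordsOf_update (i := i) (l := l) (p := ⟨i, hi⟩) rfl hl]
  set s : ℝ := 1 - ∑ k ∈ univ.erase ⟨(i : ℕ), hi⟩, x k
  rw [← lintegral_sub_left_eq_self _ s]
  refine lintegral_congr fun t => congrArg f (funext fun k => ?_)
  simp only [sub_sub_cancel]
  by_cases hkl : k = l
  · subst hkl
    simp [Function.update_of_ne hil]
  · by_cases hki : k = i
    · subst hki
      simp [Function.update_of_ne hkl]
    · rw [Function.comp_apply, Equiv.swap_apply_of_ne_of_ne hki hkl]
      simp [hki, hkl]

lemma dirDensity_comp_swap (α θ : Fin K → ℝ) (i l : Fin K) :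
    dirDensity α (θ ∘ Equiv.swap i l) = dirDensity (α ∘ Equiv.swap i l) θ :=
  Fintype.prod_equiv (Equiv.swap i l) _ _ fun k => by simp

lemma forall_pos_comp_swap (θ : Fin K → ℝ) (i l : Fin K) :
    (∀ k, 0 < (θ ∘ Equiv.swap i l) k) ↔ ∀ k, 0 < θ k :=
  (Equiv.swap i l).forall_congr_left.trans (by simp)

lemma posDensity_comp_swap (α θ : Fin K → ℝ) (i l : Fin K) :
    posDensity α (θ ∘ Equiv.swap i l) = posDensity (α ∘ Equiv.swap i l) θ := by
  simp only [posDensity, forall_pos_comp_swap, dirDensity_comp_swap]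

lemma posDensityGt_comp_swap (α θ : Fin K → ℝ) (m n i l : Fin K) :
    posDensityGt α m n (θ ∘ Equiv.swap i l) =
      posDensityGt (α ∘ Equiv.swap i l) (Equiv.swap i l m) (Equiv.swap i l n) θ := by
  simp only [posDensityGt, forall_pos_comp_swap, dirDensity_comp_swap]
  rfl

lemma dirDensity_update_update (α z : Fin K → ℝ) {i l : Fin K} (hil : i ≠ l) (t u : ℝ) :
    dirDensity α (Function.update (Function.update z i t) l u) =
      (∏ k ∈ (univ.erase l).erase i, z k ^ (α k - 1)) * (t ^ (α i - 1) * u ^ (α l - 1)) := by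
  rw [dirDensity, ← mul_prod_erase _ _ (mem_univ l),
    ← mul_prod_erase _ _ (mem_erase.2 ⟨hil, mem_univ i⟩)]
  rw [prod_congr rfl fun k hk => by
    rw [Function.update_of_ne (ne_of_mem_erase (mem_of_mem_erase hk)),
      Function.update_of_ne (ne_of_mem_erase hk)]]
  rw [Function.update_self, Function.update_of_ne hil, Function.update_self]
  ring

lemma forall_pos_update_update (z : Fin K → ℝ) {i l : Fin K} (hil : i ≠ l) (t u : ℝ) :
    (∀ k, 0 < Function.update (Function.update z i t) l u k) ↔
      (∀ k ∈ (univ.erase l).erase i, 0 < z k) ∧ 0 < t ∧ 0 < u := by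
  constructor
  · refine fun h => ⟨fun k hk => ?_, ?_, ?_⟩
    · simpa [ne_of_mem_erase hk, ne_of_mem_erase (mem_of_mem_erase hk)] using h k
    · simpa [hil] using h i
    · simpa using h l
  · rintro ⟨h, ht, hu⟩ k
    by_cases hkl : k = l
    · simpa [hkl] using hu
    · by_cases hki : k = i
      · simpa [hki, hil] using ht
      · simpa [hki, hkl] using h k (by simp [hki, hkl])

lemma lintegral_posDensityGt_last {α : Fin K → ℝ} (hα : ∀ k, 0 < α k) {i l : Fin K} (hil : i ≠ l)
    (hl : (l : ℕ) = K - 1) :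
    ∫⁻ y, posDensityGt α i l (coordsOf y) =
      ENNReal.ofReal (Ihalf (α l) (α i)) * ∫⁻ y, posDensity α (coordsOf y) := by
  have hi : (i : ℕ) < K - 1 := by
    have := i.2
    have : (i : ℕ) ≠ l := fun h => hil (Fin.ext h)
    omega
  have hm : Measurable fun y : Fin (K - 1) → ℝ => posDensity α (coordsOf y) :=
    (measurable_posDensity α).comp measurable_coordsOf
  rw [← lintegral_const_mul _ hm]
  refine lintegral_eq_of_forall_update (p := ⟨i, hi⟩)
    ((measurable_posDensityGt α i l).comp measurable_coordsOf) (hm.const_mul _) fun x => ?_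
  rw [lintegral_const_mul' _ _ ENNReal.ofReal_ne_top]
  simp only [coordsOf_update (i := i) (l := l) (p := ⟨i, hi⟩) rfl hl, posDensityGt, posDensity,
    forall_pos_update_update _ hil, dirDensity_update_update _ _ hil, Function.update_self,
    Function.update_of_ne hil]
  by_cases hP : ∀ k ∈ (univ.erase l).erase i, 0 < coordsOf x k
  · simp only [eq_true hP, true_and]
    exact lintegral_segment_gt (hα i) (hα l)
      (prod_nonneg fun k hk => (Real.rpow_pos_of_pos (hP k hk) _).le) _
  · simp only [hP, false_and, if_false, lintegral_zero, mul_zero]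

lemma lintegral_posDensityGt {α : Fin K → ℝ} (hα : ∀ k, 0 < α k) {i j : Fin K} (hij : i ≠ j) :
    ∫⁻ y, posDensityGt α i j (coordsOf y) =
      ENNReal.ofReal (Ihalf (α j) (α i)) * ∫⁻ y, posDensity α (coordsOf y) := by
  have hK : K - 1 < K := by have := i.2; omega
  set l : Fin K := ⟨K - 1, hK⟩
  by_cases hjl : j = l
  · exact lintegral_posDensityGt_last hα hij (by rw [hjl])
  rw [← lintegral_coordsOf_comp_swap hjl rfl (measurable_posDensityGt α i j),
    ← lintegral_coordsOf_comp_swap hjl rfl (measurable_posDensity α)]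
  simp only [posDensity_comp_swap, posDensityGt_comp_swap, Equiv.swap_apply_left]
  have hne : Equiv.swap j l i ≠ l := fun h =>
    hij ((Equiv.swap j l).injective (h.trans (Equiv.swap_apply_left j l).symm))
  rw [lintegral_posDensityGt_last (α := α ∘ Equiv.swap j l) (fun k => hα _) hne rfl]
  simp

lemma dirDensity_nonneg {α θ : Fin K → ℝ} (h : ∀ k, 0 < θ k) : 0 ≤ dirDensity α θ :=
  prod_nonneg fun k _ => (Real.rpow_pos_of_pos (h k) _).le

lemma simplexIntegral_eq_toReal (hK : 0 < K) {f : (Fin K → ℝ) → ℝ} (hf : Measurable f)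
    (hf0 : ∀ θ, (∀ k, 0 < θ k) → 0 ≤ f θ) :
    simplexIntegral K f =
      (∫⁻ y, if ∀ k, 0 < coordsOf y k then ENNReal.ofReal (f (coordsOf y)) else 0).toReal := by
  have hD := measurableSet_simplexDomain hK
  rw [simplexIntegral, integral_eq_lintegral_of_nonneg_ae, ← lintegral_indicator hD]
  · congr 1
    refine lintegral_congr fun y => ?_
    by_cases hy : y ∈ simplexDomain K
    · rw [Set.indicator_of_mem hy, if_pos ((mem_simplexDomain_iff hK y).1 hy)]
    · rw [Set.indicator_of_notMem hy, if_neg (mt (mem_simplexDomain_iff hK y).2 hy)]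
  · filter_upwards [ae_restrict_mem hD] with y hy using hf0 _ ((mem_simplexDomain_iff hK y).1 hy)
  · exact (hf.comp measurable_coordsOf).aestronglyMeasurable

end Coordinates

/-- `∫_Δ 1_{θ_i > θ_j} D_α(θ) dθ = I_{1/2}(α_j, α_i) ∫_Δ D_α(θ) dθ`. -/
theorem dirichlet_prob_gt (K : ℕ) (hK : 2 ≤ K) (α : Fin K → ℝ)
    (hα : ∀ k, 0 < α k) (i j : Fin K) (hij : i ≠ j) :
    simplexIntegral K (fun θ => (if θ j < θ i then (1:ℝ) else 0) * dirDensity α θ)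
      = Ihalf (α j) (α i) * simplexIntegral K (fun θ => dirDensity α θ) := by
  have hK0 : 0 < K := by omega
  have hpos := measurable_dirDensity α
  have hgt : Measurable fun θ : Fin K → ℝ =>
      (if θ j < θ i then (1 : ℝ) else 0) * dirDensity α θ :=
    (Measurable.ite (measurableSet_lt (measurable_pi_apply j) (measurable_pi_apply i))
      measurable_const measurable_const).mul hpos
  rw [simplexIntegral_eq_toReal hK0 hgt fun θ h =>
      mul_nonneg (by split_ifs <;> norm_num) (dirDensity_nonneg h),
    simplexIntegral_eq_toReal hK0 hpos fun θ h => dirDensity_nonneg h]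
  have h := congrArg ENNReal.toReal (lintegral_posDensityGt hα hij)
  rw [ENNReal.toReal_mul, ENNReal.toReal_ofReal (Ihalf_nonneg (hα j) (hα i))] at h
  refine Eq.trans (congrArg ENNReal.toReal (lintegral_congr fun y => ?_)) h
  rw [posDensityGt, ite_and]
  refine if_congr Iff.rfl ?_ rfl
  split_ifs <;> simp
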